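/- Let k ≥ 1 be an integer, set κ = k/2 + 1/4, let a : ℕ → ℂ satisfy |a(n)| ≤ C n^α for some C, α > 0, let c ≥ 1 be the smallest positive integer with a(c) ≠ 0, and suppose f(z) = ∑_{n≥1} a(n) e^{2πinz} satisfies |f(x + iy)| ≤ 𝒜 y^{−κ} for all x ∈ ℝ, y > 0. Define f₁(z) = ∑_{n=c+1}^{∞} (a(n)/log(n/c)) e^{2πinz} for Im z > 0. Then there exist η ∈ (0, 1) and a constant C′ > 0 such that for all x ∈ ℝ and all y with 0 < y < η, |f₁(x + iy)| ≤ C′ · y^{−κ} · (log(1/y))^{−1}. -/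

import Mathlib

/-- The sum `f(z) = ∑_{n≥1} a(n) e^{2πinz}` attached to coefficients `a : ℕ → ℂ`. -/
noncomputable def cuspSum (a : ℕ → ℂ) (z : ℂ) : ℂ :=
  ∑' n : ℕ, a (n + 1) * Complex.exp (2 * Real.pi * Complex.I * ((n : ℂ) + 1) * z)

/-- The modified sum `f₁(z) = ∑_{n>c} (a(n)/log(n/c)) e^{2πinz}`. -/
noncomputable def cuspSumLog (a : ℕ → ℂ) (c : ℕ) (z : ℂ) : ℂ :=
  ∑' n : ℕ, a (n + c + 1) / (Real.log (((n : ℝ) + (c : ℝ) + 1) / (c : ℝ)) : ℂ) *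
    Complex.exp (2 * Real.pi * Complex.I * ((n : ℂ) + (c : ℂ) + 1) * z)

open MeasureTheory Set

lemma summable_rpow_mul_exp_neg (α : ℝ) {r : ℝ} (hr : 0 < r) :
    Summable fun n : ℕ => ((n : ℝ) + 1) ^ α * Real.exp (-(r * (n + 1))) := by
  have h := (summable_nat_add_iff 1).2 (Real.summable_pow_mul_exp_neg_nat_mul ⌈α⌉₊ hr)
  refine Summable.of_nonneg_of_le (fun n => by positivity) (fun n => ?_) h
  push_cast
  rw [neg_mul, ← Real.rpow_natCast]
  gcongr
  · linarith [(Nat.cast_nonneg n : (0 : ℝ) ≤ n)]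
  · exact Nat.le_ceil α

lemma norm_exp_two_pi_I_mul (n x y : ℝ) :
    ‖Complex.exp (2 * Real.pi * Complex.I * (n : ℂ) * ((x : ℂ) + (y : ℂ) * Complex.I))‖ =
      Real.exp (-(2 * Real.pi * y * n)) := by
  rw [Complex.norm_exp]
  congr 1
  simp
  ring

/-- The `n`-th summand of `cuspSum a z`. -/
noncomputable def cuspSumTerm (a : ℕ → ℂ) (z : ℂ) (n : ℕ) : ℂ :=
  a (n + 1) * Complex.exp (2 * Real.pi * Complex.I * ((n : ℂ) + 1) * z)

lemma norm_cuspSumTerm_le {a : ℕ → ℂ} {C α : ℝ}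
    (ha : ∀ n : ℕ, 1 ≤ n → ‖a n‖ ≤ C * (n : ℝ) ^ α) (x y : ℝ) (n : ℕ) :
    ‖cuspSumTerm a ((x : ℂ) + (y : ℂ) * Complex.I) n‖ ≤
      C * (((n : ℝ) + 1) ^ α * Real.exp (-(2 * Real.pi * y * (n + 1)))) := by
  have h := norm_exp_two_pi_I_mul (n + 1) x y
  push_cast at h
  rw [cuspSumTerm, norm_mul, h, ← mul_assoc]
  have := ha (n + 1) (by omega)
  push_cast at this
  gcongr

lemma summable_norm_cuspSumTerm {a : ℕ → ℂ} {C α : ℝ}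
    (ha : ∀ n : ℕ, 1 ≤ n → ‖a n‖ ≤ C * (n : ℝ) ^ α) (x : ℝ) {y : ℝ} (hy : 0 < y) :
    Summable fun n : ℕ => ‖cuspSumTerm a ((x : ℂ) + (y : ℂ) * Complex.I) n‖ :=
  Summable.of_nonneg_of_le (fun _ => norm_nonneg _) (norm_cuspSumTerm_le ha x y)
    ((summable_rpow_mul_exp_neg α (by positivity)).mul_left C)

/-- A polynomial bound at the real line and exponential decay at `i∞` combine into one bound. -/
lemma exists_norm_cuspSum_le_rpow_mul_exp {a : ℕ → ℂ} {C α κ A : ℝ} (hC : 0 < C) (hκ : 0 < κ)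
    (ha : ∀ n : ℕ, 1 ≤ n → ‖a n‖ ≤ C * (n : ℝ) ^ α)
    (hf : ∀ x y : ℝ, 0 < y → ‖cuspSum a ((x : ℂ) + (y : ℂ) * Complex.I)‖ ≤ A * y ^ (-κ)) :
    ∃ B : ℝ, 0 < B ∧ ∀ x y : ℝ, 0 < y →
      ‖cuspSum a ((x : ℂ) + (y : ℂ) * Complex.I)‖ ≤ B * (y ^ (-κ) * Real.exp (-y)) := by
  have hS := summable_rpow_mul_exp_neg α (r := 2 * Real.pi) (by positivity)
  set S := ∑' n : ℕ, ((n : ℝ) + 1) ^ α * Real.exp (-(2 * Real.pi * (n + 1)))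
  have hS0 : 0 ≤ S := tsum_nonneg fun n => by positivity
  have hA : 0 ≤ A := by
    have := (norm_nonneg _).trans (hf 0 1 one_pos)
    simpa using this
  set D := C * S * (Real.exp (2 * Real.pi) * κ ^ κ)
  have hD : 0 ≤ D := by positivity
  refine ⟨A * Real.exp 1 + D + 1, by positivity, fun x y hy => ?_⟩
  have hP : 0 ≤ y ^ (-κ) * Real.exp (-y) := by positivity
  rcases le_total y 1 with h1 | h1
  · refine (hf x y hy).trans ?_
    have : A * y ^ (-κ) ≤ A * Real.exp 1 * (y ^ (-κ) * Real.exp (-y)) := by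
      have e : 1 ≤ Real.exp 1 * Real.exp (-y) := by
        rw [← Real.exp_add]; exact Real.one_le_exp (by linarith)
      have : 0 ≤ A * y ^ (-κ) := by positivity
      nlinarith
    nlinarith
  · have key : ‖cuspSum a ((x : ℂ) + (y : ℂ) * Complex.I)‖ ≤
        C * S * Real.exp (-(2 * Real.pi * (y - 1))) := by
      have hb : HasSum (fun n : ℕ => C * (((n : ℝ) + 1) ^ α *
          Real.exp (-(2 * Real.pi * (n + 1)))) * Real.exp (-(2 * Real.pi * (y - 1))))
          (C * S * Real.exp (-(2 * Real.pi * (y - 1)))) := (hS.hasSum.mul_left C).mul_right _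
      refine tsum_of_norm_bounded hb fun n => (norm_cuspSumTerm_le ha x y n).trans ?_
      rw [mul_assoc C, mul_assoc (_ ^ α), ← Real.exp_add]
      gcongr
      have : 0 ≤ Real.pi * n * (y - 1) := by
        have := sub_nonneg.2 h1
        positivity
      nlinarith
    have hpow : y ^ κ ≤ κ ^ κ * Real.exp y := by
      have h2 : y ≤ κ * Real.exp (y / κ) := by
        have := Real.add_one_le_exp (y / κ)
        calc y = κ * (y / κ) := by field_simp
          _ ≤ _ := by gcongr; linarith
      calc y ^ κ ≤ (κ * Real.exp (y / κ)) ^ κ := by gcongr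
        _ = _ := by
          rw [Real.mul_rpow hκ.le (Real.exp_pos _).le, ← Real.exp_mul]
          congr 2
          field_simp
    have h3 : Real.exp (-y) ≤ κ ^ κ * y ^ (-κ) := by
      rw [Real.rpow_neg hy.le, Real.exp_neg, ← div_eq_mul_inv, inv_eq_one_div,
        div_le_div_iff₀ (Real.exp_pos y) (by positivity)]
      linarith
    have h4 : Real.exp (-(2 * Real.pi * (y - 1))) ≤
        Real.exp (2 * Real.pi) * (Real.exp (-y) * Real.exp (-y)) := by
      rw [← Real.exp_add, ← Real.exp_add]
      gcongr
      nlinarith [Real.pi_gt_three]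
    calc _ ≤ _ := key
      _ ≤ C * S * (Real.exp (2 * Real.pi) * ((κ ^ κ * y ^ (-κ)) * Real.exp (-y))) := by
        refine mul_le_mul_of_nonneg_left (h4.trans ?_) (by positivity)
        gcongr
      _ = D * (y ^ (-κ) * Real.exp (-y)) := by ring
      _ ≤ _ := by
        gcongr
        linarith [show 0 ≤ A * Real.exp 1 by positivity]

lemma exists_Gamma_mul_le (m : ℝ) {δ : ℝ} (hδ : 0 < δ) :
    ∃ K : ℝ, 0 < K ∧ ∀ s : ℝ, 0 < s → s ≤ m → Real.Gamma (δ * s) ≤ K * Real.Gamma s := by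
  have hG : ∀ s : ℝ, 0 < s → ContinuousAt Real.Gamma s := fun s hs =>
    (Real.differentiableAt_Gamma fun j => by
      have : (0 : ℝ) ≤ j := Nat.cast_nonneg j
      linarith).continuousAt
  have hc : ContinuousOn (fun s : ℝ => Real.Gamma (δ * s + 1) / Real.Gamma (s + 1)) (Icc 0 m) := by
    intro s hs
    have h0 : 0 ≤ s := hs.1
    refine ContinuousAt.continuousWithinAt (ContinuousAt.div ?_ ?_
      (Real.Gamma_pos_of_pos (by positivity)).ne')
    · exact ContinuousAt.comp (f := fun s : ℝ => δ * s + 1) (hG _ (by positivity)) (by fun_prop)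
    · exact ContinuousAt.comp (f := fun s : ℝ => s + 1) (hG _ (by positivity)) (by fun_prop)
  obtain ⟨K, hK⟩ := isCompact_Icc.bddAbove_image hc
  refine ⟨(|K| + 1) / δ, by positivity, fun s hs hsm => ?_⟩
  have h := hK (mem_image_of_mem _ (⟨hs.le, hsm⟩ : s ∈ Icc 0 m))
  have hg := Real.Gamma_pos_of_pos hs
  rw [Real.Gamma_add_one hs.ne', Real.Gamma_add_one (by positivity), div_le_iff₀ (by positivity)] at h
  have h' : δ * s * Real.Gamma (δ * s) ≤ (|K| + 1) * (s * Real.Gamma s) :=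
    h.trans (by gcongr; linarith [le_abs_self K])
  rw [div_mul_eq_mul_div, le_div_iff₀ hδ]
  nlinarith

lemma norm_mellin_le {F : ℝ → ℂ} {B κ θ r s y : ℝ} (hr : 0 < r) (hy : 0 < y) (hB : 0 ≤ B)
    (hθ : 0 ≤ θ) (hθs : θ < s) (hθκ : θ ≤ κ)
    (hF : ∀ t, 0 < t → ‖F t‖ ≤ B * ((y + r * t) ^ (-κ) * Real.exp (-(y + r * t)))) :
    ‖mellin F s‖ ≤ B * y ^ (-κ + θ) * ((1 / r) ^ s * Real.Gamma (s - θ)) := by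
  have hint : IntegrableOn (fun t : ℝ => t ^ (s - θ - 1) * Real.exp (-(r * t))) (Ioi 0) := by
    have := integrableOn_rpow_mul_exp_neg_mul_rpow (s := s - θ - 1) (by linarith) one_pos hr
    simpa using this
  have hval := Real.integral_rpow_mul_exp_neg_mul_Ioi (a := s - θ) (sub_pos.2 hθs) hr
  have h := norm_integral_le_of_norm_le (f := fun t : ℝ => (t : ℂ) ^ ((s : ℂ) - 1) • F t)
    (hint.const_mul (B * y ^ (-κ + θ) * r ^ (-θ))) ?_
  · refine h.trans (le_of_eq ?_)
    rw [integral_const_mul, hval, one_div, Real.inv_rpow hr.le, Real.inv_rpow hr.le,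
      ← Real.rpow_neg hr.le, ← Real.rpow_neg hr.le]
    rw [show -s = -θ + -(s - θ) by ring, Real.rpow_add hr]
    ring
  · refine (ae_restrict_iff' measurableSet_Ioi).2 (Filter.Eventually.of_forall fun t ht => ?_)
    have ht : 0 < t := ht
    have hrt : 0 < r * t := by positivity
    rw [norm_smul, Complex.norm_cpow_eq_rpow_re_of_pos ht]
    simp only [Complex.sub_re, Complex.ofReal_re, Complex.one_re]
    have h1 : (y + r * t) ^ (-κ) ≤ y ^ (-κ + θ) * (r ^ (-θ) * t ^ (-θ)) := by
      rw [← Real.mul_rpow hr.le ht.le, show -κ = (-κ + θ) + -θ by ring,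
        Real.rpow_add (by positivity)]
      rw [show -κ + θ + -θ + θ = -κ + θ by ring]
      refine mul_le_mul (Real.rpow_le_rpow_of_nonpos hy (by linarith) (by linarith))
        (Real.rpow_le_rpow_of_nonpos hrt (by linarith) (by linarith)) (by positivity)
        (by positivity)
    calc t ^ (s - 1) * ‖F t‖
        ≤ t ^ (s - 1) * (B * ((y + r * t) ^ (-κ) * Real.exp (-(y + r * t)))) := by
          gcongr; exact hF t ht
      _ ≤ t ^ (s - 1) * (B * ((y ^ (-κ + θ) * (r ^ (-θ) * t ^ (-θ))) * Real.exp (-(r * t)))) := by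
          gcongr; linarith
      _ = _ := by
          rw [show s - θ - 1 = (s - 1) + -θ by ring, Real.rpow_add ht]
          ring

lemma rpow_neg_div_le (n : ℕ) {c : ℕ} (hc : 1 ≤ c) {s m : ℝ} (hs : 0 ≤ s) (hsm : s ≤ m) :
    (((n : ℝ) + 1) / c) ^ (-s) ≤ (c : ℝ) ^ m := by
  have hc' : (1 : ℝ) ≤ c := by exact_mod_cast hc
  have hn : (0 : ℝ) ≤ n := Nat.cast_nonneg n
  rw [Real.rpow_neg (by positivity), ← Real.inv_rpow (by positivity), inv_div]
  calc ((c : ℝ) / (n + 1)) ^ s ≤ (c : ℝ) ^ s := by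
        gcongr
        exact div_le_self (by positivity) (by linarith)
    _ ≤ _ := Real.rpow_le_rpow_of_exponent_le hc' hsm

lemma summable_rpow_neg_mul_cuspSumTerm {a : ℕ → ℂ} {C α : ℝ} {c : ℕ} (hc : 1 ≤ c)
    (ha : ∀ n : ℕ, 1 ≤ n → ‖a n‖ ≤ C * (n : ℝ) ^ α) (x : ℝ) {y s : ℝ} (hy : 0 < y)
    (hs : 0 ≤ s) :
    Summable fun n : ℕ => (((n : ℝ) + 1) / c) ^ (-s) *
      ‖cuspSumTerm a ((x : ℂ) + (y : ℂ) * Complex.I) n‖ :=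
  Summable.of_nonneg_of_le (fun n => by positivity)
    (fun n => mul_le_mul_of_nonneg_right (rpow_neg_div_le n hc hs le_rfl) (norm_nonneg _))
    ((summable_norm_cuspSumTerm ha x hy).mul_left _)

lemma norm_tsum_rpow_neg_mul_cuspSumTerm_le {a : ℕ → ℂ} {C α κ B : ℝ} {c : ℕ} (hc : 1 ≤ c)
    (ha : ∀ n : ℕ, 1 ≤ n → ‖a n‖ ≤ C * (n : ℝ) ^ α) (hB : 0 ≤ B)
    (hf : ∀ x y : ℝ, 0 < y →
      ‖cuspSum a ((x : ℂ) + (y : ℂ) * Complex.I)‖ ≤ B * (y ^ (-κ) * Real.exp (-y)))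
    (x : ℝ) {y s θ : ℝ} (hy : 0 < y) (hθ : 0 ≤ θ) (hθs : θ < s) (hθκ : θ ≤ κ) :
    Real.Gamma s * ‖∑' n : ℕ, (((((n : ℝ) + 1) / c) ^ (-s) : ℝ) : ℂ) *
        cuspSumTerm a ((x : ℂ) + (y : ℂ) * Complex.I) n‖ ≤
      B * y ^ (-κ + θ) * ((2 * Real.pi * c) ^ s * Real.Gamma (s - θ)) := by
  have hs : 0 < s := hθ.trans_lt hθs
  have hc0 : (0 : ℝ) < c := by exact_mod_cast hc
  set r : ℝ := 1 / (2 * Real.pi * c) with hr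
  have hr0 : 0 < r := by positivity
  have hM := hasSum_mellin (a := cuspSumTerm a ((x : ℂ) + (y : ℂ) * Complex.I))
    (p := fun n : ℕ => ((n : ℝ) + 1) / c) (s := s)
    (F := fun t : ℝ => cuspSum a ((x : ℂ) + ((y + r * t : ℝ) : ℂ) * Complex.I))
    (fun n => Or.inr (by positivity)) (by simpa using hs) ?_ ?_
  · have hM' := norm_mellin_le hr0 hy hB hθ hθs hθκ
      (F := fun t : ℝ => cuspSum a ((x : ℂ) + ((y + r * t : ℝ) : ℂ) * Complex.I))
      (fun t ht => hf x _ (by positivity))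
    rw [← hM.tsum_eq] at hM'
    refine le_trans (le_of_eq ?_) (hM'.trans (le_of_eq ?_))
    · rw [← Real.norm_of_nonneg (Real.Gamma_pos_of_pos hs).le, ← Complex.norm_real, ← norm_mul,
        ← tsum_mul_left, Complex.Gamma_ofReal]
      congr 1
      refine tsum_congr fun n => ?_
      rw [Real.rpow_neg (by positivity), Complex.ofReal_inv,
        Complex.ofReal_cpow (by positivity), div_eq_mul_inv]
      ring
    · rw [hr, one_div_one_div]
  · intro t ht
    have ht : 0 < t := ht
    have hterm : ∀ n : ℕ, cuspSumTerm a ((x : ℂ) + (y : ℂ) * Complex.I) n *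
        (Real.exp (-(((n : ℝ) + 1) / c) * t) : ℂ) =
        cuspSumTerm a ((x : ℂ) + ((y + r * t : ℝ) : ℂ) * Complex.I) n := by
      intro n
      rw [cuspSumTerm, cuspSumTerm, mul_assoc, Complex.ofReal_exp, ← Complex.exp_add]
      congr 2
      have hpi : (Real.pi : ℂ) ≠ 0 := by exact_mod_cast Real.pi_ne_zero
      have hcc : (c : ℂ) ≠ 0 := by exact_mod_cast hc0.ne'
      rw [hr]
      push_cast
      field_simp
      ring_nf
      simp only [Complex.I_sq]
      ring
    simp only [hterm]
    exact (summable_norm_cuspSumTerm ha x (y := y + r * t) (by positivity)).of_norm.hasSum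
  · refine (summable_rpow_neg_mul_cuspSumTerm hc ha x hy hs.le).congr fun n => ?_
    rw [Complex.ofReal_re, Real.rpow_neg (by positivity)]
    ring

lemma integral_rpow_neg {q : ℝ} (hq : 1 < q) (m : ℝ) :
    ∫ s in (0 : ℝ)..m, q ^ (-s) = (1 - q ^ (-m)) / Real.log q := by
  have hq0 : 0 < q := by linarith
  have hl := (Real.log_pos hq).ne'
  have hd : ∀ s ∈ uIcc 0 m, HasDerivAt (fun s : ℝ => -(q ^ (-s)) / Real.log q) (q ^ (-s)) s := by
    intro s _
    have := (((hasDerivAt_id s).neg.const_rpow hq0).neg).div_const (Real.log q)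
    refine this.congr_deriv ?_
    simp
    field_simp
  rw [intervalIntegral.integral_eq_sub_of_hasDerivAt hd]
  · simp
    ring
  · refine Continuous.intervalIntegrable ?_ _ _
    exact continuous_const.rpow continuous_neg fun _ => Or.inl hq0.ne'

lemma hasSum_integral_rpow_neg_mul_cuspSumTerm {a : ℕ → ℂ} {C α : ℝ} {c : ℕ} (hc : 1 ≤ c)
    (ha : ∀ n : ℕ, 1 ≤ n → ‖a n‖ ≤ C * (n : ℝ) ^ α) (x : ℝ) {y m : ℝ} (hy : 0 < y)
    (hm : 0 ≤ m) :
    HasSum (fun n : ℕ => ((∫ s in (0 : ℝ)..m, (((n : ℝ) + 1) / c) ^ (-s) : ℝ) : ℂ) *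
        cuspSumTerm a ((x : ℂ) + (y : ℂ) * Complex.I) n)
      (∫ s in (0 : ℝ)..m, ∑' n : ℕ, (((((n : ℝ) + 1) / c) ^ (-s) : ℝ) : ℂ) *
        cuspSumTerm a ((x : ℂ) + (y : ℂ) * Complex.I) n) := by
  have hc0 : (0 : ℝ) < c := by exact_mod_cast hc
  have hT := summable_norm_cuspSumTerm ha x hy
  have hbd : ∀ (n : ℕ) (s : ℝ), s ∈ uIoc 0 m →
      ‖(((((n : ℝ) + 1) / c) ^ (-s) : ℝ) : ℂ) *
        cuspSumTerm a ((x : ℂ) + (y : ℂ) * Complex.I) n‖ ≤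
      (c : ℝ) ^ m * ‖cuspSumTerm a ((x : ℂ) + (y : ℂ) * Complex.I) n‖ := by
    intro n s hs
    rw [uIoc_of_le hm] at hs
    rw [norm_mul, Complex.norm_real, Real.norm_of_nonneg (by positivity)]
    gcongr
    exact rpow_neg_div_le n hc hs.1.le hs.2
  have h := intervalIntegral.hasSum_integral_of_dominated_convergence (μ := volume) (a := 0) (b := m)
    (F := fun (n : ℕ) (s : ℝ) => (((((n : ℝ) + 1) / c) ^ (-s) : ℝ) : ℂ) *
        cuspSumTerm a ((x : ℂ) + (y : ℂ) * Complex.I) n)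
    (f := fun s : ℝ => ∑' n : ℕ, (((((n : ℝ) + 1) / c) ^ (-s) : ℝ) : ℂ) *
        cuspSumTerm a ((x : ℂ) + (y : ℂ) * Complex.I) n)
    (fun n _ => (c : ℝ) ^ m * ‖cuspSumTerm a ((x : ℂ) + (y : ℂ) * Complex.I) n‖)
    (fun n => ?_) (fun n => Filter.Eventually.of_forall (hbd n))
    (Filter.Eventually.of_forall fun s _ => hT.mul_left _) intervalIntegrable_const
    (Filter.Eventually.of_forall fun s hs =>
      (Summable.of_norm_bounded (hT.mul_left _) fun n => hbd n s hs).hasSum)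
  · simpa only [intervalIntegral.integral_mul_const, intervalIntegral.integral_ofReal] using h
  · refine Continuous.aestronglyMeasurable ?_
    refine Continuous.mul (Complex.continuous_ofReal.comp ?_) continuous_const
    exact continuous_const.rpow continuous_neg fun _ => Or.inl (by positivity)

lemma norm_cuspSumTerm_le_norm (a : ℕ → ℂ) (x : ℝ) {y : ℝ} (hy : 0 < y) (n : ℕ) :
    ‖cuspSumTerm a ((x : ℂ) + (y : ℂ) * Complex.I) n‖ ≤ ‖a (n + 1)‖ := by
  have h := norm_exp_two_pi_I_mul (n + 1) x y
  push_cast at h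
  rw [cuspSumTerm, norm_mul, h]
  refine mul_le_of_le_one_right (norm_nonneg _) (Real.exp_le_one_iff.2 ?_)
  rw [Left.neg_nonpos_iff]
  positivity

/-- Since `1 / log q = ∫₀ᵐ q⁻ˢ ds + q⁻ᵐ / log q`, for large `m` the modified series is, up to a
bounded error, an integral of the series with coefficients `a n * (n / c) ^ (-s)`. -/
lemma exists_norm_cuspSumLog_sub_integral_le {a : ℕ → ℂ} {C α : ℝ} {c : ℕ} (hc : 1 ≤ c)
    (ha : ∀ n : ℕ, 1 ≤ n → ‖a n‖ ≤ C * (n : ℝ) ^ α) {m : ℝ} (hm : 0 ≤ m) (hαm : α + 1 < m) :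
    ∃ M : ℝ, 0 ≤ M ∧ ∀ x y : ℝ, 0 < y →
      ‖cuspSumLog a c ((x : ℂ) + (y : ℂ) * Complex.I) -
        ∫ s in (0 : ℝ)..m, ∑' n : ℕ, (((((n : ℝ) + 1) / c) ^ (-s) : ℝ) : ℂ) *
          cuspSumTerm a ((x : ℂ) + (y : ℂ) * Complex.I) n‖ ≤ M := by
  have hc0 : (0 : ℝ) < c := by exact_mod_cast hc
  set J : ℕ → ℝ := fun n => ∫ s in (0 : ℝ)..m, (((n : ℝ) + 1) / c) ^ (-s) with hJ
  set q : ℕ → ℝ := fun n => ((n : ℝ) + c + 1) / c with hqdef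
  have hq0 : 1 < q 0 := by
    simp only [hqdef]
    rw [one_lt_div hc0]
    simp
  have hqq : ∀ n, q 0 ≤ q n := by
    intro n
    simp only [hqdef]
    gcongr
    simp
  have hq : ∀ n, 1 < q n := fun n => hq0.trans_le (hqq n)
  have hJq : ∀ n, J (n + c) = (1 - q n ^ (-m)) / Real.log (q n) := by
    intro n
    rw [← integral_rpow_neg (hq n)]
    simp only [hJ, hqdef]
    push_cast
    rfl
  set b : ℕ → ℝ := fun n =>
    C * (c : ℝ) ^ m / Real.log (q 0) * ((n + c + 1 : ℕ) : ℝ) ^ (α - m) with hb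
  have hbs : Summable b := by
    refine Summable.mul_left _ ?_
    have := (summable_nat_add_iff (c + 1)).2 (Real.summable_nat_rpow.2 (by linarith : α - m < -1))
    simpa only [add_assoc] using this
  refine ⟨∑' n, b n + ∑ n ∈ Finset.range c, |J n| * ‖a (n + 1)‖, ?_, fun x y hy => ?_⟩
  · have hC : 0 ≤ C := by simpa using (norm_nonneg _).trans (ha 1 le_rfl)
    have hl := Real.log_pos hq0
    have : 0 ≤ ∑' n, b n := tsum_nonneg fun n => by positivity
    positivity
  set T := cuspSumTerm a ((x : ℂ) + (y : ℂ) * Complex.I) with hT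
  have hs := hasSum_integral_rpow_neg_mul_cuspSumTerm hc ha x hy hm
  have hsplit := hs.summable.sum_add_tsum_nat_add c
  rw [hs.tsum_eq] at hsplit
  rw [← hsplit]
  set R : ℕ → ℂ := fun n => ((q n ^ (-m) / Real.log (q n) : ℝ) : ℂ) * T (n + c) with hR
  have hRb : ∀ n, ‖R n‖ ≤ b n := by
    intro n
    have hqn : 0 < q n := by linarith [hq n]
    have hl := Real.log_pos hq0
    have hl' : Real.log (q 0) ≤ Real.log (q n) := Real.log_le_log (by linarith) (hqq n)
    have hpos : (0 : ℝ) < ((n + c + 1 : ℕ) : ℝ) := by positivity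
    have hl'' : 0 < Real.log (q n) := hl.trans_le hl'
    have h1 := (norm_cuspSumTerm_le_norm a x hy (n + c)).trans (ha (n + c + 1) (by omega))
    rw [hR, norm_mul, Complex.norm_real, Real.norm_of_nonneg (by positivity)]
    calc q n ^ (-m) / Real.log (q n) * ‖T (n + c)‖
        ≤ q n ^ (-m) / Real.log (q 0) * (C * ((n + c + 1 : ℕ) : ℝ) ^ α) := by gcongr
      _ = b n := by
        have : q n = ((n + c + 1 : ℕ) : ℝ) / c := by simp only [hqdef]; push_cast; rfl
        rw [this, Real.div_rpow hpos.le hc0.le, Real.rpow_neg hc0.le]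
        simp only [hb]
        rw [sub_eq_add_neg, Real.rpow_add hpos]
        field_simp
  have hRs : Summable R := Summable.of_norm_bounded hbs hRb
  have hJs : Summable fun n => ((J (n + c) : ℝ) : ℂ) * T (n + c) :=
    (summable_nat_add_iff (f := fun n => ((J n : ℝ) : ℂ) * T n) c).2 hs.summable
  have hlog : cuspSumLog a c ((x : ℂ) + (y : ℂ) * Complex.I) =
      ∑' n, ((J (n + c) : ℝ) : ℂ) * T (n + c) + ∑' n, R n := by
    rw [← hJs.tsum_add hRs]
    refine tsum_congr fun n => ?_
    rw [hR, hJq, ← add_mul, ← Complex.ofReal_add, ← add_div, sub_add_cancel, hT, cuspSumTerm]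
    push_cast
    simp only [hqdef]
    ring
  rw [hlog, add_comm (∑ n ∈ Finset.range c, _), add_sub_add_left_eq_sub]
  refine (norm_sub_le _ _).trans ?_
  refine add_le_add (tsum_of_norm_bounded hbs.hasSum hRb) ?_
  refine (norm_sum_le _ _).trans (Finset.sum_le_sum fun n _ => ?_)
  rw [norm_mul, Complex.norm_real, Real.norm_eq_abs]
  exact mul_le_mul_of_nonneg_left (norm_cuspSumTerm_le_norm a x hy n) (abs_nonneg _)

lemma exists_norm_integral_tsum_le {a : ℕ → ℂ} {C α κ B : ℝ} {c : ℕ} (hc : 1 ≤ c)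
    (ha : ∀ n : ℕ, 1 ≤ n → ‖a n‖ ≤ C * (n : ℝ) ^ α) (hB : 0 ≤ B)
    (hf : ∀ x y : ℝ, 0 < y →
      ‖cuspSum a ((x : ℂ) + (y : ℂ) * Complex.I)‖ ≤ B * (y ^ (-κ) * Real.exp (-y)))
    (hκ : 1 / 2 ≤ κ) {m : ℝ} (hm : 1 ≤ m) :
    ∃ D : ℝ, 0 ≤ D ∧ ∀ x y : ℝ, 0 < y → y < 1 →
      ‖∫ s in (0 : ℝ)..m, ∑' n : ℕ, (((((n : ℝ) + 1) / c) ^ (-s) : ℝ) : ℂ) *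
          cuspSumTerm a ((x : ℂ) + (y : ℂ) * Complex.I) n‖ ≤
        D * (y ^ (-κ) * (Real.log (1 / y))⁻¹) := by
  have hc1 : (1 : ℝ) ≤ c := by exact_mod_cast hc
  have hm0 : 0 < m := by linarith
  set ε : ℝ := 1 / (2 * m) with hε
  have hε0 : 0 < ε := by positivity
  have hεm : ε * m = 1 / 2 := by rw [hε]; field_simp
  have hε1 : ε < 1 := by nlinarith
  obtain ⟨K, hK, hG⟩ := exists_Gamma_mul_le m (sub_pos.2 hε1)
  refine ⟨B * K * (2 * Real.pi * c) ^ m / ε, by positivity, fun x y hy hy1 => ?_⟩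
  set q : ℝ := y ^ (-ε) with hq
  have hq1 : 1 < q := Real.one_lt_rpow_of_pos_of_lt_one_of_neg hy hy1 (by linarith)
  have hbase : 1 ≤ 2 * Real.pi * c := by nlinarith [Real.pi_gt_three]
  have hl : 0 < Real.log (1 / y) := Real.log_pos (by rw [one_lt_div hy]; exact hy1)
  have hcont : Continuous fun s : ℝ => q ^ (-s) :=
    continuous_const.rpow continuous_neg fun _ => Or.inl (by positivity)
  have h := intervalIntegral.norm_integral_le_of_norm_le (μ := volume) hm0.le
    (f := fun s : ℝ => ∑' n : ℕ, (((((n : ℝ) + 1) / c) ^ (-s) : ℝ) : ℂ) *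
      cuspSumTerm a ((x : ℂ) + (y : ℂ) * Complex.I) n)
    (g := fun s => B * K * (2 * Real.pi * c) ^ m * y ^ (-κ) * q ^ (-s))
    (Filter.Eventually.of_forall fun s hs => ?_)
    ((hcont.const_mul _).intervalIntegrable _ _)
  · refine h.trans ?_
    rw [intervalIntegral.integral_const_mul, integral_rpow_neg hq1, hq, Real.log_rpow hy, ← hq]
    have hlog : -ε * Real.log y = ε * Real.log (1 / y) := by
      rw [one_div, Real.log_inv]; ring
    rw [hlog]
    calc _ ≤ B * K * (2 * Real.pi * c) ^ m * y ^ (-κ) * (1 / (ε * Real.log (1 / y))) := by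
          gcongr
          have : 0 ≤ q ^ (-m) := by positivity
          linarith
      _ = _ := by field_simp
  · have hs0 : 0 < s := hs.1
    have hs' : ε * s ≤ ε * m := mul_le_mul_of_nonneg_left hs.2 hε0.le
    have hk := norm_tsum_rpow_neg_mul_cuspSumTerm_le hc ha hB hf x hy (s := s) (θ := ε * s)
      (by positivity) (by nlinarith) (by linarith)
    have hg := hG s hs0 hs.2
    rw [show (1 - ε) * s = s - ε * s by ring] at hg
    have hgp := Real.Gamma_pos_of_pos hs0
    have hqs : y ^ (-κ + ε * s) = y ^ (-κ) * q ^ (-s) := by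
      rw [hq, ← Real.rpow_mul hy.le, ← Real.rpow_add hy]
      congr 1
      ring
    refine le_of_mul_le_mul_left (hk.trans ?_) hgp
    calc B * y ^ (-κ + ε * s) * ((2 * Real.pi * c) ^ s * Real.Gamma (s - ε * s))
        ≤ B * y ^ (-κ + ε * s) * ((2 * Real.pi * c) ^ m * (K * Real.Gamma s)) := by
          gcongr
          · exact Real.Gamma_nonneg_of_nonneg (by nlinarith)
          · exact hs.2
      _ = _ := by rw [hqs]; ring

/-- small-`Im z` bound for the modified series `f₁`:
there are `η ∈ (0,1)` and `C' > 0` with `|f₁(x+iy)| ≤ C' y^{−κ} (log(1/y))⁻¹`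
for all `0 < y < η`, where `κ = k/2 + 1/4`. -/
theorem stmt_14 (k : ℕ) (hk : 1 ≤ k)
    (a : ℕ → ℂ) (C α : ℝ) (hC : 0 < C) (hα : 0 < α)
    (ha : ∀ n : ℕ, 1 ≤ n → ‖a n‖ ≤ C * (n : ℝ) ^ α)
    (c : ℕ) (hc : 1 ≤ c) (hac : a c ≠ 0)
    (hmin : ∀ m : ℕ, 1 ≤ m → m < c → a m = 0)
    (𝒜 : ℝ)
    (hf : ∀ x y : ℝ, 0 < y →
      ‖cuspSum a ((x : ℂ) + (y : ℂ) * Complex.I)‖ ≤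
        𝒜 * y ^ (-((k : ℝ) / 2 + 1 / 4))) :
    ∃ η ∈ Set.Ioo (0 : ℝ) 1, ∃ C' > (0 : ℝ), ∀ x y : ℝ, 0 < y → y < η →
      ‖cuspSumLog a c ((x : ℂ) + (y : ℂ) * Complex.I)‖ ≤
        C' * y ^ (-((k : ℝ) / 2 + 1 / 4)) * (Real.log (1 / y))⁻¹ := by
  have hκ0 : 0 < (k : ℝ) / 2 + 1 / 4 := by positivity
  have hκ : 1 / 2 ≤ (k : ℝ) / 2 + 1 / 4 := by
    have : (1 : ℝ) ≤ k := by exact_mod_cast hk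
    linarith
  set κ : ℝ := (k : ℝ) / 2 + 1 / 4
  obtain ⟨B, hB, hfB⟩ := exists_norm_cuspSum_le_rpow_mul_exp hC hκ0 ha hf
  obtain ⟨D, hD, hint⟩ :=
    exists_norm_integral_tsum_le hc ha hB.le hfB hκ (m := α + 2) (by linarith)
  obtain ⟨M, hM, hdiff⟩ :=
    exists_norm_cuspSumLog_sub_integral_le hc ha (m := α + 2) (by linarith) (by linarith)
  refine ⟨1 / 2, by norm_num, D + M / κ + 1, by positivity, fun x y hy hy2 => ?_⟩
  have hy1 : y < 1 := by linarith
  have hl : 0 < Real.log (1 / y) := Real.log_pos (by rw [one_lt_div hy]; exact hy1)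
  have hlog : κ ≤ y ^ (-κ) * (Real.log (1 / y))⁻¹ := by
    have h := Real.log_le_rpow_div (x := 1 / y) (by positivity) hκ0
    rw [one_div, Real.inv_rpow hy.le, ← Real.rpow_neg hy.le, ← one_div, le_div_iff₀ hκ0] at h
    rw [← div_eq_mul_inv, le_div_iff₀ hl]
    linarith
  have hP : 0 < y ^ (-κ) * (Real.log (1 / y))⁻¹ := by positivity
  have hMP : M ≤ M / κ * (y ^ (-κ) * (Real.log (1 / y))⁻¹) := by
    calc M = M / κ * κ := by field_simp
      _ ≤ _ := by gcongr
  have h1 := hint x y hy hy1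
  have h2 := hdiff x y hy
  have h3 := norm_le_norm_add_norm_sub' (cuspSumLog a c ((x : ℂ) + (y : ℂ) * Complex.I))
    (∫ s in (0 : ℝ)..(α + 2), ∑' n : ℕ, (((((n : ℝ) + 1) / c) ^ (-s) : ℝ) : ℂ) *
      cuspSumTerm a ((x : ℂ) + (y : ℂ) * Complex.I) n)
  rw [mul_assoc]
  linarith
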